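/- Let (X_η, S) be a hereditary B-free subshift and let u ∈ {0,1}^ℤ be the sequence with u(0) = 1 and u(n) = 0 for n ≠ 0. If τ is a surjective cellular automaton on (X_η, S) with τ(u) ≠ 0^ℤ, then τ = S^r for some r ∈ ℤ. -/

import Mathlib

open Filter Set

noncomputable section

/-- The shift by `t`: `(shiftPow t x) n = x (n + t)`, i.e. `S^t`. -/
def shiftPow (t : ℤ) (x : ℤ → Bool) : ℤ → Bool := fun n => x (n + t)

/-- The left shift `S`, `(S x) n = x (n + 1)`. -/
def shift : (ℤ → Bool) → (ℤ → Bool) := shiftPow 1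

/-- The support of a `0-1`-sequence. -/
def supp (x : ℤ → Bool) : Set ℤ := {n | x n = true}

/-- The all-zero sequence `0^ℤ`. -/
def zeroSeq : ℤ → Bool := fun _ => false

/-- The all-one sequence `1^ℤ`. -/
def oneSeq : ℤ → Bool := fun _ => true

/-- The sequence `u = 0^{-ℕ} 1 0^{ℕ}` with a single `1` at position `0`. -/
def uSeq : ℤ → Bool := fun n => if n = 0 then true else false

/-- The set `F_B ⊆ ℤ` of `B`-free integers. -/
def BFreeSet (B : Set ℕ) : Set ℤ := {n | ∀ b ∈ B, ¬ ((b : ℤ) ∣ n)}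

open Classical in
/-- `η`, the indicator function of the `B`-free integers. -/
noncomputable def eta (B : Set ℕ) : ℤ → Bool := fun n => if n ∈ BFreeSet B then true else false

/-- The `B`-free subshift `X_η`: the orbit closure of `η` under the shift. -/
def Xeta (B : Set ℕ) : Set (ℤ → Bool) := closure {x | ∃ t : ℤ, x = shiftPow t (eta B)}

/-- A set `A ⊆ ℤ` is `B`-admissible if for every `b ∈ B` some residue class
mod `b` is disjoint from `A`. -/
def IsBAdmissible (B : Set ℕ) (A : Set ℤ) : Prop :=
  ∀ b ∈ B, ∃ r : ℤ, ∀ a ∈ A, ¬ ((b : ℤ) ∣ (a - r))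

/-- The `B`-admissible subshift `X_B`. -/
def XB (B : Set ℕ) : Set (ℤ → Bool) := {x | IsBAdmissible B (supp x)}

/-- `B` is primitive: no element divides a different element. -/
def Primitive (B : Set ℕ) : Prop := ∀ a ∈ B, ∀ b ∈ B, a ∣ b → a = b

/-- `B` is an Erdős set: infinite, `1 ∉ B` (elements positive), primitive, pairwise
coprime and thin. -/
def IsErdos (B : Set ℕ) : Prop :=
  B.Infinite ∧ (∀ b ∈ B, 2 ≤ b) ∧ Primitive B ∧
    (∀ a ∈ B, ∀ b ∈ B, a ≠ b → Nat.Coprime a b) ∧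
    Summable (fun b : B => (1 : ℝ) / (b : ℝ))

/-- A cellular automaton on `X`: a continuous self-map of `X` commuting with the shift. -/
def IsCA (X : Set (ℤ → Bool)) (τ : (ℤ → Bool) → (ℤ → Bool)) : Prop :=
  Set.MapsTo τ X X ∧ ContinuousOn τ X ∧ ∀ x ∈ X, τ (shift x) = shift (τ x)

/-- Pre-injectivity of a CA on `X`. -/
def PreInjective (X : Set (ℤ → Bool)) (τ : (ℤ → Bool) → (ℤ → Bool)) : Prop :=
  ∀ x ∈ X, ∀ y ∈ X, τ x = τ y → {n : ℤ | x n ≠ y n}.Finite → x = y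

/-- `X` is hereditary. -/
def Hereditary (X : Set (ℤ → Bool)) : Prop :=
  ∀ x ∈ X, ∀ y : ℤ → Bool, (∀ n, y n ≤ x n) → y ∈ X

/-- The hereditary closure `X̃` of a set `X`. -/
def heredClosure (X : Set (ℤ → Bool)) : Set (ℤ → Bool) :=
  {y | ∃ x ∈ X, ∀ n, y n ≤ x n}

/-- `X` is a subshift: nonempty, closed and shift-invariant. -/
def IsSubshift (X : Set (ℤ → Bool)) : Prop :=
  X.Nonempty ∧ IsClosed X ∧ shift '' X = X

/-- `τ` is given by a (sliding block) code of radius `ℓ` on `X`. -/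
def HasRadius (X : Set (ℤ → Bool)) (τ : (ℤ → Bool) → (ℤ → Bool)) (ℓ : ℕ) : Prop :=
  ∀ x ∈ X, ∀ y ∈ X, ∀ n : ℤ,
    (∀ i : ℤ, n - ℓ ≤ i → i ≤ n + ℓ → x i = y i) → τ x n = τ y n

open Classical in
/-- `A ⊆ ℤ` has logarithmic density `d`. -/
noncomputable def HasLogDensity (A : Set ℤ) (d : ℝ) : Prop :=
  Tendsto (fun N : ℕ =>
      (Real.log N)⁻¹ * ∑ n ∈ Finset.Icc 1 N, (if (n : ℤ) ∈ A then (1 : ℝ) / (n : ℝ) else 0))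
    atTop (nhds d)

/-- `B` is taut: removing any `b ∈ B` strictly increases the logarithmic density of the
`B`-free integers. -/
def IsTaut (B : Set ℕ) : Prop :=
  ∀ b ∈ B, ∀ d d' : ℝ,
    HasLogDensity (BFreeSet B) d → HasLogDensity (BFreeSet (B \ {b})) d' → d < d'

/-- `x` and `y` are proximal: along some sequence `r k → ∞`, the shifted sequences
`S^{r k} x` and `S^{r k} y` agree on arbitrarily large central windows, i.e.
`d(S^{r k} x, S^{r k} y) → 0` in the product topology. -/
def ProximalPair (x y : ℤ → Bool) : Prop :=
  ∃ r : ℕ → ℤ, Tendsto r atTop atTop ∧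
    ∀ m : ℕ, ∀ᶠ k in atTop, ∀ n : ℤ, |n| ≤ (m : ℤ) →
      shiftPow (r k) x n = shiftPow (r k) y n

/-- A subshift is proximal if every pair of its points is proximal. -/
def IsProximalSubshift (X : Set (ℤ → Bool)) : Prop :=
  ∀ x ∈ X, ∀ y ∈ X, ProximalPair x y

end

/-- `n` is congruent modulo `b` to some `B`-free integer. -/
def HitsClass (B : Set ℕ) (b : ℕ) (n : ℤ) : Prop := ∃ f ∈ BFreeSet B, (b : ℤ) ∣ n - f

/-- The support of `x` meets every residue class modulo `b` met by the `B`-free integers. -/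
def IsFull (B : Set ℕ) (b : ℕ) (x : ℤ → Bool) : Prop :=
  ∀ f ∈ BFreeSet B, ∃ a, x a = true ∧ (b : ℤ) ∣ a - f

theorem eta_eq_true {B : Set ℕ} {n : ℤ} : eta B n = true ↔ n ∈ BFreeSet B := by
  simp [eta]

theorem HitsClass.congr {B : Set ℕ} {b : ℕ} {m n : ℤ} (h : HitsClass B b m)
    (hd : (b : ℤ) ∣ n - m) : HitsClass B b n := by
  obtain ⟨f, hf, hfd⟩ := h
  exact ⟨f, hf, by simpa using dvd_add hd hfd⟩

theorem hitsClass_of_mem {B : Set ℕ} {b : ℕ} {n : ℤ} (h : n ∈ BFreeSet B) : HitsClass B b n :=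
  ⟨n, h, by simp⟩

theorem not_hitsClass_of_dvd {B : Set ℕ} {b : ℕ} (hb : b ∈ B) {n : ℤ} (h : (b : ℤ) ∣ n) :
    ¬ HitsClass B b n := by
  rintro ⟨f, hf, hfd⟩
  exact hf b hb ((dvd_sub_right h).1 hfd)

theorem hitsClass_add_mul {B : Set ℕ} {b : ℕ} {t : ℤ}
    (h : ∀ n, HitsClass B b n → HitsClass B b (n + t)) {n : ℤ} (hn : HitsClass B b n) (j : ℕ) :
    HitsClass B b (n + j * t) := by
  induction j with
  | zero => simpa using hn
  | succ j ih =>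
    have := h _ ih
    convert this using 1
    push_cast
    ring

theorem mem_Xeta_iff {B : Set ℕ} {x : ℤ → Bool} :
    x ∈ Xeta B ↔ ∀ N : ℕ, ∃ t : ℤ, ∀ n : ℤ, |n| ≤ N → x n = eta B (n + t) := by
  constructor
  · intro hx N
    have hopen : IsOpen {y : ℤ → Bool | ∀ n ∈ Finset.Icc (-(N : ℤ)) N, y n = x n} := by
      have : {y : ℤ → Bool | ∀ n ∈ Finset.Icc (-(N : ℤ)) N, y n = x n}
          = (↑(Finset.Icc (-(N : ℤ)) N) : Set ℤ).pi (fun n => {x n}) := by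
        ext y
        simp [Set.pi]
      rw [this]
      exact isOpen_set_pi (Finset.finite_toSet _) (fun _ _ => isOpen_discrete _)
    obtain ⟨y, hy, t, rfl⟩ := mem_closure_iff.1 hx _ hopen (fun n _ => rfl)
    exact ⟨t, fun n hn => (hy n (Finset.mem_Icc.2 (abs_le.1 hn))).symm⟩
  · intro h
    choose t ht using h
    refine mem_closure_of_tendsto (f := fun N : ℕ => shiftPow (t N) (eta B)) (b := atTop) ?_
      (Eventually.of_forall fun N => ⟨t N, rfl⟩)
    rw [tendsto_pi_nhds]
    intro n
    refine tendsto_const_nhds.congr' ?_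
    filter_upwards [eventually_ge_atTop n.natAbs] with N hN
    exact ht N n (by rw [Int.abs_eq_natAbs]; exact_mod_cast hN)

theorem shiftPow_eta_mem (B : Set ℕ) (t : ℤ) : shiftPow t (eta B) ∈ Xeta B :=
  subset_closure ⟨t, rfl⟩

theorem eta_mem (B : Set ℕ) : eta B ∈ Xeta B :=
  subset_closure ⟨0, by funext n; simp [shiftPow]⟩

theorem shiftPow_mem {B : Set ℕ} {x : ℤ → Bool} (hx : x ∈ Xeta B) (s : ℤ) :
    shiftPow s x ∈ Xeta B := by
  rw [mem_Xeta_iff] at hx ⊢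
  intro N
  obtain ⟨t, ht⟩ := hx (N + s.natAbs)
  refine ⟨s + t, fun n hn => ?_⟩
  have := ht (n + s) (by
    push_cast
    exact (abs_add_le n s).trans (by simpa using hn))
  simpa [shiftPow, add_assoc] using this

theorem shiftPow_shiftPow (s t : ℤ) (x : ℤ → Bool) :
    shiftPow s (shiftPow t x) = shiftPow (s + t) x := by
  funext n
  simp [shiftPow, add_assoc]

/-- Finitely many elements of the support already represent all classes. -/
theorem IsFull.exists_bound {B : Set ℕ} {b : ℕ} (hb : 0 < b) {x : ℤ → Bool}
    (hx : IsFull B b x) :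
    ∃ N : ℕ, ∀ n, HitsClass B b n → ∃ a : ℤ, |a| ≤ N ∧ x a = true ∧ (b : ℤ) ∣ a - n := by
  have h : ∀ n, ∃ a, HitsClass B b n → x a = true ∧ (b : ℤ) ∣ a - n := by
    intro n
    by_cases hn : HitsClass B b n
    · obtain ⟨f, hf, hfd⟩ := hn
      obtain ⟨a, ha, had⟩ := hx f hf
      exact ⟨a, fun _ => ⟨ha, by simpa using dvd_sub had hfd⟩⟩
    · exact ⟨0, fun h => absurd h hn⟩
  choose a ha using h
  refine ⟨∑ r ∈ Finset.range b, (a r).natAbs, fun n hn => ?_⟩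
  have hb' : (0 : ℤ) < b := by exact_mod_cast hb
  obtain ⟨r, hr⟩ := Int.eq_ofNat_of_zero_le (Int.emod_nonneg n hb'.ne')
  have hrb : r < b := by
    have := Int.emod_lt_of_pos n hb'
    omega
  have hd : (b : ℤ) ∣ (r : ℤ) - n := by
    rw [← hr]
    exact dvd_sub_comm.1 (Int.dvd_self_sub_emod)
  obtain ⟨h1, h2⟩ := ha r (hn.congr hd)
  refine ⟨a r, ?_, h1, by simpa using dvd_add h2 hd⟩
  rw [Int.abs_eq_natAbs]
  exact_mod_cast Finset.single_le_sum (f := fun r : ℕ => (a r).natAbs) (fun _ _ => Nat.zero_le _)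
    (Finset.mem_range.2 hrb)

/-- A point of `X_η` meeting all residue classes of the `B`-free integers meets no other one. -/
theorem IsFull.hitsClass {B : Set ℕ} {b : ℕ} (hb : 0 < b) {x : ℤ → Bool} (hx : x ∈ Xeta B)
    (hfull : IsFull B b x) {c : ℤ} (hc : x c = true) : HitsClass B b c := by
  obtain ⟨N, hN⟩ := hfull.exists_bound hb
  obtain ⟨t, ht⟩ := mem_Xeta_iff.1 hx (N + c.natAbs)
  have hmem : ∀ a, |a| ≤ ((N + c.natAbs : ℕ) : ℤ) → x a = true → a + t ∈ BFreeSet B :=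
    fun a ha hxa => eta_eq_true.1 (by rw [← ht a ha, hxa])
  have hstep : ∀ n, HitsClass B b n → HitsClass B b (n + t) := by
    intro n hn
    obtain ⟨a, haN, hxa, had⟩ := hN n hn
    have := hitsClass_of_mem (b := b) (hmem a (by push_cast; linarith [abs_nonneg c]) hxa)
    exact this.congr (by simpa using dvd_sub_comm.1 had)
  have hct : HitsClass B b (c + t) :=
    hitsClass_of_mem (hmem c (by push_cast; linarith [Nat.cast_nonneg (α := ℤ) N]) hc)
  refine (hitsClass_add_mul hstep hct (b - 1)).congr ⟨-t, ?_⟩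
  rw [Nat.cast_pred hb]
  ring

theorem isFull_eta (B : Set ℕ) (b : ℕ) : IsFull B b (eta B) :=
  fun f hf => ⟨f, eta_eq_true.2 hf, by simp⟩

/-- `η` is a maximal element of `X_η`. -/
theorem eq_eta_of_le {B : Set ℕ} (hB : ∀ b ∈ B, 0 < b) {x : ℤ → Bool} (hx : x ∈ Xeta B)
    (h : ∀ n, eta B n = true → x n = true) : x = eta B := by
  funext n
  rw [Bool.eq_iff_iff]
  refine ⟨fun hn => eta_eq_true.2 fun b hb hd => ?_, h n⟩
  have hfull : IsFull B b x := fun f hf => ⟨f, h f (eta_eq_true.2 hf), by simp⟩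
  exact not_hitsClass_of_dvd hb hd (hfull.hitsClass (hB b hb) hx hn)

theorem one_mem_BFreeSet {B : Set ℕ} (hB : ∀ b ∈ B, 2 ≤ b) : (1 : ℤ) ∈ BFreeSet B := by
  intro b hb hd
  have := hB b hb
  have := Int.le_of_dvd one_pos hd
  omega

theorem neg_one_mem_BFreeSet {B : Set ℕ} (hB : ∀ b ∈ B, 2 ≤ b) : (-1 : ℤ) ∈ BFreeSet B :=
  fun b hb hd => one_mem_BFreeSet hB b hb ((dvd_neg).1 hd)

theorem Hereditary.mem_of_imp {X : Set (ℤ → Bool)} (hX : Hereditary X) {x y : ℤ → Bool}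
    (hx : x ∈ X) (h : ∀ n, y n = true → x n = true) : y ∈ X :=
  hX x hx y fun n => by
    have := h n
    cases hy : y n <;> simp_all

theorem uSeq_mem {B : Set ℕ} (hB : ∀ b ∈ B, 2 ≤ b) (hX : Hereditary (Xeta B)) :
    uSeq ∈ Xeta B := by
  refine hX.mem_of_imp (shiftPow_eta_mem B 1) fun n hn => ?_
  have : n = 0 := by simpa [uSeq] using hn
  subst this
  exact eta_eq_true.2 (by simpa using one_mem_BFreeSet hB)

theorem exists_mem_BFreeSet_lt_abs {B : Set ℕ} (hB : ∀ b ∈ B, 2 ≤ b) (hX : Hereditary (Xeta B))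
    (M : ℕ) : ∃ g ∈ BFreeSet B, (M : ℤ) < |g| := by
  by_contra! hM
  obtain ⟨t, ht⟩ := mem_Xeta_iff.1 (uSeq_mem hB hX) (2 * M + 2)
  have hiff : ∀ n : ℤ, |n| ≤ ((2 * M + 2 : ℕ) : ℤ) → (n + t ∈ BFreeSet B ↔ n = 0) := by
    intro n hn
    rw [← eta_eq_true, ← ht n hn]
    simp [uSeq]
  have h0 := hM _ ((hiff 0 (by simp; positivity)).2 rfl)
  have h1 := (hiff (1 - t) (by rw [abs_le] at *; push_cast; omega)).1
    (by simpa using one_mem_BFreeSet hB)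
  have h2 := (hiff (-1 - t) (by rw [abs_le] at *; push_cast; omega)).1
    (by simpa using neg_one_mem_BFreeSet hB)
  omega

/-- In the hereditary case every residue class met by the `B`-free integers is met by
`B`-free integers of arbitrarily large absolute value. -/
theorem exists_far_mem_BFreeSet {B : Set ℕ} (hB : ∀ b ∈ B, 2 ≤ b) (hX : Hereditary (Xeta B))
    {b : ℕ} (hb : 0 < b) {n : ℤ} (hn : HitsClass B b n) (T : ℕ) :
    ∃ a ∈ BFreeSet B, (T : ℤ) < |a| ∧ (b : ℤ) ∣ a - n := by
  obtain ⟨N, hN⟩ := (isFull_eta B b).exists_bound hb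
  obtain ⟨g, hg, hgT⟩ := exists_mem_BFreeSet_lt_abs hB hX (T + 2 * N)
  let x : ℤ → Bool := fun m => decide (|m| ≤ N) && eta B m
  have hx : x ∈ Xeta B := hX.mem_of_imp (eta_mem B) fun m hm => by
    simp only [x, Bool.and_eq_true] at hm
    exact hm.2
  obtain ⟨t, ht⟩ := mem_Xeta_iff.1 hx (g.natAbs + T + 2 * N)
  have hmem : ∀ m : ℤ, |m| ≤ ((g.natAbs + T + 2 * N : ℕ) : ℤ) →
      (m + t ∈ BFreeSet B ↔ |m| ≤ N ∧ m ∈ BFreeSet B) := by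
    intro m hm
    rw [← eta_eq_true, ← ht m hm]
    simp [x, eta_eq_true]
  have htT : (T : ℤ) + N < |t| := by
    by_contra! hle
    have := ((hmem (g - t) (by
      have := abs_sub g t
      push_cast
      linarith [Nat.cast_nonneg (α := ℤ) N])).1 (by simpa using hg)).1
    have h2 := abs_sub_abs_le_abs_sub g t
    push_cast at hgT
    linarith
  have hrep : ∀ m, HitsClass B b m → ∃ a : ℤ, |a| ≤ N ∧ a + t ∈ BFreeSet B ∧ (b : ℤ) ∣ a - m := by
    intro m hm
    obtain ⟨a, haN, ha, had⟩ := hN m hm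
    refine ⟨a, haN, (hmem a ?_).2 ⟨haN, eta_eq_true.1 ha⟩, had⟩
    push_cast
    linarith [abs_nonneg g, Nat.cast_nonneg (α := ℤ) T, Nat.cast_nonneg (α := ℤ) N]
  have hstep : ∀ m, HitsClass B b m → HitsClass B b (m + t) := by
    intro m hm
    obtain ⟨a, -, ha, had⟩ := hrep m hm
    exact (hitsClass_of_mem ha).congr (by simpa using dvd_sub_comm.1 had)
  obtain ⟨a, haN, ha, had⟩ := hrep _ (hitsClass_add_mul hstep hn (b - 1))
  refine ⟨a + t, ha, ?_, ?_⟩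
  · have := abs_sub_abs_le_abs_sub t (-a)
    rw [abs_neg, sub_neg_eq_add, add_comm t a] at this
    linarith
  · have : a + t - n = (a - (n + ((b - 1 : ℕ) : ℤ) * t)) + b * t := by
      rw [Nat.cast_pred hb]
      ring
    rw [this]
    exact dvd_add had (dvd_mul_right _ _)

/-- Full sets of representatives can be chosen with large gaps, and far from a given point. -/
theorem exists_sparse_full {B : Set ℕ} (hB : ∀ b ∈ B, 2 ≤ b) (hX : Hereditary (Xeta B))
    {b : ℕ} (hb : 0 < b) (D : ℕ) (t : ℤ) :
    ∃ A : Finset ℤ, (∀ a ∈ A, a ∈ BFreeSet B) ∧ (∀ a ∈ A, (D : ℤ) < |a - t|) ∧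
      (∀ a ∈ A, ∀ a' ∈ A, a ≠ a' → (D : ℤ) < |a - a'|) ∧
      ∀ n, HitsClass B b n → ∃ a ∈ A, (b : ℤ) ∣ a - n := by
  have key : ∀ j : ℕ, ∃ A : Finset ℤ, (∀ a ∈ A, a ∈ BFreeSet B) ∧ (∀ a ∈ A, (D : ℤ) < |a - t|) ∧
      (∀ a ∈ A, ∀ a' ∈ A, a ≠ a' → (D : ℤ) < |a - a'|) ∧
      ∀ r : ℕ, r < j → HitsClass B b r → ∃ a ∈ A, (b : ℤ) ∣ a - r := by
    intro j
    induction j with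
    | zero => exact ⟨∅, by simp⟩
    | succ j ih =>
      obtain ⟨A, h1, h2, h3, h4⟩ := ih
      by_cases hj : HitsClass B b j
      · obtain ⟨a, ha, haT, had⟩ := exists_far_mem_BFreeSet hB hX hb hj
          (D + t.natAbs + ∑ a ∈ A, a.natAbs)
        push_cast at haT
        have hle : ∀ a' ∈ A, |a'| ≤ ∑ c ∈ A, |c| := fun a' ha' =>
          Finset.single_le_sum (f := fun c : ℤ => |c|) (fun _ _ => abs_nonneg _) ha'
        have hfar : ∀ a' ∈ A, (D : ℤ) < |a - a'| := fun a' ha' => by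
          have := abs_sub_abs_le_abs_sub a a'
          linarith [hle a' ha', abs_nonneg t]
        refine ⟨insert a A, ?_, ?_, ?_, ?_⟩
        · simpa using ⟨ha, h1⟩
        · simp only [Finset.mem_insert, forall_eq_or_imp]
          refine ⟨?_, h2⟩
          have := abs_sub_abs_le_abs_sub a t
          linarith [Finset.sum_nonneg (s := A) (f := fun c : ℤ => |c|) fun _ _ => abs_nonneg _]
        · intro c hc c' hc' hne
          rcases Finset.mem_insert.1 hc with hca | hcA <;>
            rcases Finset.mem_insert.1 hc' with hca' | hcA'
          · exact absurd (hca.trans hca'.symm) hne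
          · exact hca ▸ hfar _ hcA'
          · rw [abs_sub_comm, hca']
            exact hfar _ hcA
          · exact h3 _ hcA _ hcA' hne
        · intro r hr hrR
          rcases Nat.lt_succ_iff_lt_or_eq.1 hr with hr | rfl
          · obtain ⟨c, hc, hcd⟩ := h4 r hr hrR
            exact ⟨c, Finset.mem_insert_of_mem hc, hcd⟩
          · exact ⟨a, Finset.mem_insert_self _ _, had⟩
      · refine ⟨A, h1, h2, h3, fun r hr hrR => ?_⟩
        rcases Nat.lt_succ_iff_lt_or_eq.1 hr with hr | rfl
        · exact h4 r hr hrR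
        · exact absurd hrR hj
  obtain ⟨A, h1, h2, h3, h4⟩ := key b
  refine ⟨A, h1, h2, h3, fun n hn => ?_⟩
  have hb' : (0 : ℤ) < b := by exact_mod_cast hb
  obtain ⟨r, hr⟩ := Int.eq_ofNat_of_zero_le (Int.emod_nonneg n hb'.ne')
  have hrb : r < b := by
    have := Int.emod_lt_of_pos n hb'
    omega
  have hd : (b : ℤ) ∣ (r : ℤ) - n := by
    rw [← hr]
    exact dvd_sub_comm.1 (Int.dvd_self_sub_emod)
  obtain ⟨a, ha, had⟩ := h4 r hrb (hn.congr hd)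
  exact ⟨a, ha, by simpa using dvd_add had hd⟩

/-- If the zero sequence belongs to `X_η`, every nonzero integer is coprime to some `b ∈ B`. -/
theorem exists_isCoprime {B : Set ℕ} (hX : Hereditary (Xeta B)) {m : ℤ}
    (hm : m ≠ 0) : ∃ b ∈ B, IsCoprime (b : ℤ) m := by
  have hzero : zeroSeq ∈ Xeta B := hX.mem_of_imp (eta_mem B) fun n hn => by simp [zeroSeq] at hn
  obtain ⟨t, ht⟩ := mem_Xeta_iff.1 hzero m.natAbs
  have h1 := Int.emod_nonneg (1 - t) hm
  have h2 := Int.emod_lt_abs (1 - t) hm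
  have h3 := ht ((1 - t) % m) (by rw [abs_of_nonneg h1, ← Int.abs_eq_natAbs]; exact h2.le)
  have h4 : (1 - t) % m + t ∉ BFreeSet B := fun h => by
    rw [eta_eq_true.2 h] at h3
    simp [zeroSeq] at h3
  simp only [BFreeSet, Set.mem_ofPred_eq, not_forall, not_not] at h4
  obtain ⟨b, hb, c, hc⟩ := h4
  refine ⟨b, hb, c, (1 - t) / m, ?_⟩
  have := Int.emod_add_mul_ediv (1 - t) m
  linarith

section CellularAutomaton

variable {B : Set ℕ} {τ : (ℤ → Bool) → (ℤ → Bool)}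

theorem IsCA.map_shiftPow (hτ : IsCA (Xeta B) τ) {x : ℤ → Bool} (hx : x ∈ Xeta B) (t : ℤ) :
    τ (shiftPow t x) = shiftPow t (τ x) := by
  have hnat : ∀ (j : ℕ) (y : ℤ → Bool), y ∈ Xeta B → τ (shiftPow j y) = shiftPow j (τ y) := by
    intro j
    induction j with
    | zero =>
      intro y _
      have h0 : ∀ z : ℤ → Bool, shiftPow ((0 : ℕ) : ℤ) z = z := fun z => by
        funext n
        simp [shiftPow]
      rw [h0, h0]
    | succ j ih =>
      intro y hy
      have h1 : ∀ z : ℤ → Bool, shiftPow ((j + 1 : ℕ) : ℤ) z = shift (shiftPow j z) := fun z => by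
        rw [shift, shiftPow_shiftPow]
        push_cast
        rw [add_comm]
      rw [h1, h1, hτ.2.2 _ (shiftPow_mem hy _), ih y hy]
  obtain ⟨j, rfl | rfl⟩ := Int.eq_nat_or_neg t
  · exact hnat j x hx
  · have h := hnat j _ (shiftPow_mem hx (-j))
    have h0 : ∀ z : ℤ → Bool, shiftPow 0 z = z := fun z => by
      funext n
      simp [shiftPow]
    rw [shiftPow_shiftPow, add_neg_cancel, h0] at h
    rw [h, shiftPow_shiftPow, neg_add_cancel, h0]

/-- The Curtis–Hedlund–Lyndon theorem. -/
theorem IsCA.exists_hasRadius (hτ : IsCA (Xeta B) τ) : ∃ ℓ : ℕ, HasRadius (Xeta B) τ ℓ := by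
  suffices h : ∃ ℓ : ℕ, ∀ x ∈ Xeta B, ∀ y ∈ Xeta B,
      (∀ i : ℤ, |i| ≤ ℓ → x i = y i) → τ x 0 = τ y 0 by
    obtain ⟨ℓ, hℓ⟩ := h
    refine ⟨ℓ, fun x hx y hy n hxy => ?_⟩
    have := hℓ _ (shiftPow_mem hx n) _ (shiftPow_mem hy n) fun i hi => by
      rw [abs_le] at hi
      exact hxy (i + n) (by linarith) (by linarith)
    rw [hτ.map_shiftPow hx, hτ.map_shiftPow hy] at this
    simpa [shiftPow] using this
  by_contra! hne
  have hcpt : CompactSpace (Xeta B) := isCompact_iff_compactSpace.1 isClosed_closure.isCompact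
  let Z : ℕ → Set (Xeta B × Xeta B) := fun ℓ =>
    {p | (∀ i : ℤ, |i| ≤ ℓ → p.1.1 i = p.2.1 i) ∧ τ p.1.1 0 ≠ τ p.2.1 0}
  have hcont : Continuous fun x : Xeta B => τ x.1 0 :=
    (continuous_apply 0).comp (continuousOn_iff_continuous_domRestrict.1 hτ.2.1)
  have hclosed : ∀ ℓ, IsClosed (Z ℓ) := by
    intro ℓ
    refine IsClosed.and ?_ ?_
    · simp only [Set.ofPred_forall]
      refine isClosed_iInter fun i => isClosed_iInter fun _ => ?_
      exact isClosed_eq ((continuous_apply i).comp (continuous_subtype_val.comp continuous_fst))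
        ((continuous_apply i).comp (continuous_subtype_val.comp continuous_snd))
    · have : Continuous fun p : Xeta B × Xeta B => (τ p.1.1 0, τ p.2.1 0) :=
        (hcont.comp continuous_fst).prodMk (hcont.comp continuous_snd)
      exact (isClosed_discrete {q : Bool × Bool | q.1 ≠ q.2}).preimage this
  obtain ⟨p, hp⟩ := IsCompact.nonempty_iInter_of_sequence_nonempty_isCompact_isClosed Z
    (fun ℓ p hp => ⟨fun i hi => hp.1 i (by push_cast; linarith), hp.2⟩)
    (fun ℓ => by
      obtain ⟨x, hx, y, hy, hxy, hn⟩ := hne ℓ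
      exact ⟨(⟨x, hx⟩, ⟨y, hy⟩), hxy, hn⟩)
    (hclosed 0).isCompact hclosed
  rw [Set.mem_iInter] at hp
  refine (hp 0).2 ?_
  have : p.1.1 = p.2.1 := funext fun i => (hp i.natAbs).1 i (by rw [Int.abs_eq_natAbs])
  rw [this]

/-- The image of a point near an isolated `1` is a copy of the image of `u`. -/
theorem IsCA.apply_isolated (hτ : IsCA (Xeta B) τ) {ℓ : ℕ} (hℓ : HasRadius (Xeta B) τ ℓ)
    (hu : uSeq ∈ Xeta B) {x : ℤ → Bool} (hx : x ∈ Xeta B) {a k : ℤ} (ha : x a = true)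
    (hiso : ∀ n, |n - a| ≤ ℓ + |k| → x n = true → n = a) : τ x (a + k) = τ uSeq k := by
  have h := hℓ x hx (shiftPow (-a) uSeq) (shiftPow_mem hu _) (a + k) fun i hi1 hi2 => by
    have hd : |i - a| ≤ ℓ + |k| := by
      have h1 := neg_abs_le k
      have h2 := le_abs_self k
      rw [abs_le]
      constructor <;> linarith
    rw [Bool.eq_iff_iff]
    simp only [shiftPow, uSeq, Bool.if_false_right, Bool.and_true, decide_eq_true_eq]
    constructor
    · intro h
      rw [hiso i hd h]
      ring
    · intro h
      rwa [show i = a by linarith]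
  rw [h, hτ.map_shiftPow hu]
  simp [shiftPow]

theorem IsCA.image_uSeq_subsingleton (hτ : IsCA (Xeta B) τ) (hB : ∀ b ∈ B, 2 ≤ b)
    (hX : Hereditary (Xeta B)) {k k' : ℤ} (hk : τ uSeq k = true) (hk' : τ uSeq k' = true) :
    k = k' := by
  by_contra hne
  have hu := uSeq_mem hB hX
  obtain ⟨ℓ, hℓ⟩ := hτ.exists_hasRadius
  obtain ⟨b, hb, hcop⟩ := exists_isCoprime hX (sub_ne_zero.2 hne)
  have hb0 : 0 < b := by linarith [hB b hb]
  obtain ⟨A, hAF, -, hAs, hA⟩ := exists_sparse_full hB hX hb0 (ℓ + k.natAbs + k'.natAbs) 0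
  let x : ℤ → Bool := fun n => decide (n ∈ A)
  have hx : x ∈ Xeta B := hX.mem_of_imp (eta_mem B) fun n hn =>
    eta_eq_true.2 (hAF n (by simpa [x] using hn))
  have hτx : ∀ j, |j| ≤ |k| + |k'| → τ uSeq j = true → ∀ a ∈ A, τ x (a + j) = true := by
    intro j hj hju a ha
    rw [hτ.apply_isolated hℓ hu hx (by simpa [x] using ha), hju]
    intro n hn hxn
    by_contra hna
    have := hAs n (by simpa [x] using hxn) a ha hna
    push_cast at this
    linarith
  let y : ℤ → Bool := shiftPow k' (τ x)
  have hy : y ∈ Xeta B := shiftPow_mem (hτ.1 hx) _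
  have hfull : IsFull B b y := by
    intro f hf
    obtain ⟨a, ha, had⟩ := hA f (hitsClass_of_mem hf)
    exact ⟨a, hτx k' (by linarith [abs_nonneg k]) hk' a ha, had⟩
  have hstep : ∀ n, HitsClass B b n → HitsClass B b (n + (k - k')) := by
    intro n hn
    obtain ⟨a, ha, had⟩ := hA n hn
    have h1 : y (a + (k - k')) = true := by
      have := hτx k (by linarith [abs_nonneg k']) hk a ha
      simpa [y, shiftPow, add_assoc] using this
    exact (hfull.hitsClass hb0 hy h1).congr (by simpa using dvd_sub_comm.1 had)
  obtain ⟨c, d, hcd⟩ := hcop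
  have hb0' : (b : ℤ) ≠ 0 := by exact_mod_cast hb0.ne'
  obtain ⟨j, hj⟩ := Int.eq_ofNat_of_zero_le (Int.emod_nonneg (-d) hb0')
  refine not_hitsClass_of_dvd hb ?_
    (hitsClass_add_mul hstep (hitsClass_of_mem (one_mem_BFreeSet hB)) j)
  rw [← hj]
  have h1 := Int.emod_add_mul_ediv (-d) b
  refine ⟨c - (-d / b) * (k - k'), ?_⟩
  linear_combination (-1 : ℤ) * hcd + (k - k') * h1

theorem IsCA.le_of_map_uSeq (hτ : IsCA (Xeta B) τ) (hB : ∀ b ∈ B, 2 ≤ b)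
    (hX : Hereditary (Xeta B)) (hτu : τ uSeq = uSeq) {x : ℤ → Bool} (hx : x ∈ Xeta B)
    (h : τ x 0 = true) : x 0 = true := by
  by_contra hx0
  have hu := uSeq_mem hB hX
  obtain ⟨ℓ, hℓ⟩ := hτ.exists_hasRadius
  obtain ⟨t, ht⟩ := mem_Xeta_iff.1 hx ℓ
  have htF : t ∉ BFreeSet B := by
    rw [ht 0 (by simp), zero_add, eta_eq_true] at hx0
    exact hx0
  simp only [BFreeSet, Set.mem_ofPred_eq, not_forall, not_not] at htF
  obtain ⟨b, hb, hbt⟩ := htF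
  have hb0 : 0 < b := by linarith [hB b hb]
  obtain ⟨A, hAF, hAt, hAs, hA⟩ := exists_sparse_full hB hX hb0 (2 * ℓ) t
  push_cast at hAt hAs
  have hℓ0 : (0 : ℤ) ≤ ℓ := Nat.cast_nonneg _
  let y : ℤ → Bool := fun n => decide (n + t ∈ A) || (decide (|n| ≤ ℓ) && x n)
  have hy : y ∈ Xeta B := hX.mem_of_imp (shiftPow_eta_mem B t) fun n hn => by
    simp only [y, Bool.or_eq_true, Bool.and_eq_true, decide_eq_true_eq] at hn
    rcases hn with hn | ⟨hn, hxn⟩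
    · exact eta_eq_true.2 (hAF _ hn)
    · rw [ht n hn] at hxn
      exact hxn
  have hyx : τ y 0 = τ x 0 := hℓ y hy x hx 0 fun i hi1 hi2 => by
    have hi : |i| ≤ ℓ := abs_le.2 ⟨by linarith, by linarith⟩
    have hiA : i + t ∉ A := fun h => by
      have := hAt _ h
      rw [add_sub_cancel_right] at this
      linarith
    simp [y, hi, hiA]
  have hyA : ∀ a ∈ A, τ y (a - t) = true := by
    intro a ha
    have h1 := hτ.apply_isolated hℓ hu hy (a := a - t) (k := 0) (by simp [y, ha]) fun n hn hyn => by
      rw [abs_zero, add_zero] at hn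
      simp only [y, Bool.or_eq_true, Bool.and_eq_true, decide_eq_true_eq] at hyn
      rcases hyn with hyn | ⟨hyn, -⟩
      · by_contra hna
        have := hAs _ hyn a ha (by intro h; exact hna (by linarith))
        rw [show n + t - a = n - (a - t) by ring] at this
        linarith
      · have h2 := hAt a ha
        have h3 := abs_sub_abs_le_abs_sub (a - t) n
        rw [abs_sub_comm] at hn
        linarith
    rw [add_zero] at h1
    rw [h1, hτu]
    simp [uSeq]
  let z : ℤ → Bool := shiftPow (-t) (τ y)
  have hz : z ∈ Xeta B := shiftPow_mem (hτ.1 hy) _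
  have hfull : IsFull B b z := by
    intro f hf
    obtain ⟨a, ha, had⟩ := hA f (hitsClass_of_mem hf)
    exact ⟨a, hyA a ha, had⟩
  refine not_hitsClass_of_dvd hb hbt (hfull.hitsClass hb0 hz ?_)
  simp only [z, shiftPow, add_neg_cancel]
  rw [hyx, h]

theorem IsCA.eqOn_id_of_map_uSeq (hτ : IsCA (Xeta B) τ) (hB : ∀ b ∈ B, 2 ≤ b)
    (hX : Hereditary (Xeta B)) (hsurj : Set.SurjOn τ (Xeta B) (Xeta B)) (hτu : τ uSeq = uSeq) :
    Set.EqOn τ id (Xeta B) := by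
  have hle : ∀ x ∈ Xeta B, ∀ n, τ x n = true → x n = true := by
    intro x hx n hn
    have := hτ.le_of_map_uSeq hB hX hτu (shiftPow_mem hx n) (by
      rw [hτ.map_shiftPow hx]
      simpa [shiftPow] using hn)
    simpa [shiftPow] using this
  obtain ⟨w, hw, hwη⟩ := hsurj (eta_mem B)
  have hη : τ (eta B) = eta B := by
    have hw' : w = eta B := eq_eta_of_le (fun b hb => by linarith [hB b hb]) hw
      fun n hn => hle w hw n (by rw [hwη, hn])
    rw [hw'] at hwη
    exact hwη
  obtain ⟨ℓ, hℓ⟩ := hτ.exists_hasRadius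
  intro x hx
  funext n
  obtain ⟨t, ht⟩ := mem_Xeta_iff.1 (shiftPow_mem hx n) ℓ
  have h := hℓ _ (shiftPow_mem hx n) _ (shiftPow_eta_mem B t) 0 fun i hi1 hi2 =>
    ht i (abs_le.2 ⟨by linarith, by linarith⟩)
  rw [hτ.map_shiftPow hx, hτ.map_shiftPow (eta_mem B), hη] at h
  have h0 := ht 0 (by simp)
  simp only [shiftPow, zero_add] at h h0
  rw [h, id, h0]

theorem IsCA.shiftPow_comp (hτ : IsCA (Xeta B) τ) (t : ℤ) :
    IsCA (Xeta B) fun x => shiftPow t (τ x) := by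
  refine ⟨fun x hx => shiftPow_mem (hτ.1 hx) t, ?_, fun x hx => ?_⟩
  · have : Continuous (shiftPow t) := continuous_pi fun n => continuous_apply (n + t)
    exact this.comp_continuousOn hτ.2.1
  · change shiftPow t (τ (shift x)) = shift (shiftPow t (τ x))
    rw [hτ.2.2 x hx, shift, shiftPow_shiftPow, shiftPow_shiftPow, add_comm]

end CellularAutomaton

/-- on a hereditary `B`-free subshift, a surjective CA with `τ u ≠ 0^ℤ`
is a power of the shift. -/
theorem surjective_ca_with_u_nonzero (B : Set ℕ)
    (hBpos : ∀ b ∈ B, 2 ≤ b) (hBprim : Primitive B)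
    (hhered : Hereditary (Xeta B))
    (τ : (ℤ → Bool) → (ℤ → Bool)) (hτ : IsCA (Xeta B) τ)
    (hsurj : Set.SurjOn τ (Xeta B) (Xeta B))
    (hu : τ uSeq ≠ zeroSeq) :
    ∃ r : ℤ, Set.EqOn τ (shiftPow r) (Xeta B) := by
  have huX := uSeq_mem hBpos hhered
  obtain ⟨k, hk⟩ : ∃ k, τ uSeq k = true := by
    by_contra! h
    exact hu (funext fun n => by simpa [zeroSeq] using h n)
  have h0 : ∀ z : ℤ → Bool, shiftPow 0 z = z := fun z => by
    funext n
    simp [shiftPow]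
  have hτu : shiftPow k (τ uSeq) = uSeq := by
    funext n
    rw [Bool.eq_iff_iff]
    simp only [shiftPow, uSeq, Bool.if_false_right, Bool.and_true, decide_eq_true_eq]
    constructor
    · intro h
      have := hτ.image_uSeq_subsingleton hBpos hhered h hk
      linarith
    · rintro rfl
      simpa using hk
  have hsurj' : Set.SurjOn (fun x => shiftPow k (τ x)) (Xeta B) (Xeta B) := by
    intro y hy
    obtain ⟨x, hx, hxy⟩ := hsurj (shiftPow_mem hy (-k))
    refine ⟨x, hx, ?_⟩
    simp only [hxy]
    rw [shiftPow_shiftPow, add_neg_cancel, h0]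
  refine ⟨-k, fun x hx => ?_⟩
  have h := (hτ.shiftPow_comp k).eqOn_id_of_map_uSeq hBpos hhered hsurj' hτu hx
  have h' : shiftPow k (τ x) = x := h
  rw [← h', shiftPow_shiftPow, neg_add_cancel, h0, h']
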